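/- Let S ⊆ ℤ^m be a k-dimensional vector semigroup with asymptotic cone O = rint(cone(S)). For every x ∈ O \ {0} there exists a basis (a₁, …, a_k) of lin(S) with all a_i ∈ S such that x lies in the relative interior of cone(a₁, …, a_k). Moreover, if π is a semigroup homomorphism from S to another vector semigroup T with π(a₀) ≠ 0 for some a₀ ∈ S, the a_i can be chosen so that π(a_i) ≠ 0 for all i. -/

import Mathlib

open Set Filter Topology MeasureTheory ProbabilityTheory Pointwise

noncomputable section

/-- Coercion of an integer vector to a real vector. -/
def zc {m : ℕ} (x : Fin m → ℤ) : Fin m → ℝ := fun i => (x i : ℝ)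

/-- Convex conical hull: all finite nonnegative real combinations of elements of `A`. -/
def coneHull {m : ℕ} (A : Set (Fin m → ℝ)) : Set (Fin m → ℝ) :=
  { x | ∃ (s : Finset (Fin m → ℝ)) (w : (Fin m → ℝ) → ℝ),
      ↑s ⊆ A ∧ (∀ a ∈ s, 0 ≤ w a) ∧ x = ∑ a ∈ s, w a • a }

open scoped Matrix

theorem mem_ii {m : ℕ} (C : Set (Fin m → ℝ)) (V : Submodule ℝ (Fin m → ℝ)) (h0 : (0 : Fin m → ℝ) ∈ C)
    (hV : Submodule.span ℝ C = V) (x : Fin m → ℝ) :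
    x ∈ intrinsicInterior ℝ C ↔ x ∈ V ∧ C ∈ 𝓝[(V : Set (Fin m → ℝ))] x := by
  have hA : (affineSpan ℝ C : Set (Fin m → ℝ)) = (V : Set (Fin m → ℝ)) := by
    have : affineSpan ℝ C = affineSpan ℝ (insert 0 C) := by
      rw [Set.insert_eq_of_mem h0]
    rw [this, affineSpan_insert_zero, hV]
  rw [mem_intrinsicInterior, ← hA]
  constructor
  · rintro ⟨y, hy, rfl⟩
    refine ⟨by rw [← SetLike.mem_coe, ← hA]; exact y.2, ?_⟩
    rw [mem_interior_iff_mem_nhds] at hy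
    exact preimage_coe_mem_nhds_subtype.1 hy
  · rintro ⟨h1, h2⟩
    rw [← SetLike.mem_coe, ← hA] at h1
    refine ⟨⟨x, h1⟩, ?_, rfl⟩
    rw [mem_interior_iff_mem_nhds]
    exact preimage_coe_mem_nhds_subtype.2 h2

theorem zero_mem_coneHull {m : ℕ} (A : Set (Fin m → ℝ)) : 0 ∈ coneHull A :=
  ⟨∅, 0, by simp, by simp, by simp⟩

theorem subset_coneHull {m : ℕ} (A : Set (Fin m → ℝ)) : A ⊆ coneHull A := fun a ha =>
  ⟨{a}, 1, by simpa using ha, by simp, by simp⟩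

theorem span_coneHull {m : ℕ} (A : Set (Fin m → ℝ)) :
    Submodule.span ℝ (coneHull A) = Submodule.span ℝ A := by
  apply le_antisymm
  · rw [Submodule.span_le]
    rintro x ⟨s, w, hs, -, rfl⟩
    exact Submodule.sum_mem _ fun a ha => Submodule.smul_mem _ _ (Submodule.subset_span (hs ha))
  · exact Submodule.span_mono (subset_coneHull A)

theorem sum_mem_coneHull {m k : ℕ} (a : Fin k → Fin m → ℝ) (hinj : Function.Injective a)
    (c : Fin k → ℝ) (hc : ∀ i, 0 ≤ c i) : ∑ i, c i • a i ∈ coneHull (Set.range a) := by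
  classical
  refine ⟨Finset.univ.image a, Function.extend a c 0, by simp, ?_, ?_⟩
  · intro b hb
    obtain ⟨i, -, rfl⟩ := Finset.mem_image.1 hb
    rw [hinj.extend_apply]; exact hc i
  · rw [Finset.sum_image (fun _ _ _ _ h => hinj h)]
    simp [hinj.extend_apply]

theorem zc_add {m : ℕ} (x y : Fin m → ℤ) : zc (x + y) = zc x + zc y := by
  ext i; simp [zc]

/-- scaled semigroup is dense in the cone -/
theorem dense_cone {m : ℕ} (S S' : Set (Fin m → ℤ)) (a0 : Fin m → ℤ) (ha0 : a0 ∈ S)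
    (hSadd : ∀ x ∈ S, ∀ y ∈ S, x + y ∈ S)
    (hS' : ∀ u ∈ S, u + a0 ∈ S' ∨ u + a0 + a0 ∈ S') (y : Fin m → ℝ)
    (hy : y ∈ coneHull (zc '' S)) :
    y ∈ closure {z | ∃ r : ℝ, 0 < r ∧ ∃ s ∈ S', z = r • zc s} := by
  obtain ⟨F, w, hF, hw, rfl⟩ := hy
  have h1 : ∀ c : (Fin m → ℝ) → ℕ, ∃ u ∈ S, zc u = ∑ a ∈ F, (c a : ℝ) • a + zc a0 := by
    intro c
    have key : ∀ G : Finset (Fin m → ℝ), (↑G : Set _) ⊆ zc '' S →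
        ∃ u ∈ S, zc u = ∑ a ∈ G, (c a : ℝ) • a + zc a0 := by
      classical
      intro G
      induction G using Finset.induction_on with
      | empty => intro _; exact ⟨a0, ha0, by simp⟩
      | insert b G hb ih =>
        intro hG
        rw [Finset.coe_insert, Set.insert_subset_iff] at hG
        obtain ⟨u, hu, hue⟩ := ih hG.2
        obtain ⟨v, hv, rfl⟩ := hG.1
        have : ∀ n : ℕ, ∃ u' ∈ S, zc u' = (n : ℝ) • zc v + zc u := by
          intro n
          induction n with
          | zero => exact ⟨u, hu, by simp⟩
          | succ n ih =>
            obtain ⟨u', hu', h⟩ := ih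
            refine ⟨v + u', hSadd _ hv _ hu', ?_⟩
            rw [zc_add, h]; push_cast; module
        obtain ⟨u', hu', h⟩ := this (c (zc v))
        refine ⟨u', hu', ?_⟩
        rw [h, hue, Finset.sum_insert hb, add_assoc]
    exact key F hF
  have h2 : ∀ N : ℕ, ∃ j : ℝ, 0 ≤ j ∧ j ≤ 3 ∧ ∃ s ∈ S',
      zc s = ∑ a ∈ F, ((⌊w a * N⌋₊ : ℕ) : ℝ) • a + j • zc a0 := by
    intro N
    obtain ⟨u, hu, h⟩ := h1 (fun a => ⌊w a * N⌋₊)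
    rcases hS' u hu with h' | h'
    · exact ⟨2, by norm_num, by norm_num, _, h', by rw [zc_add, h]; module⟩
    · exact ⟨3, by norm_num, by norm_num, _, h', by rw [zc_add, zc_add, h]; module⟩
  choose j hj0 hj3 s hs hse using h2
  refine mem_closure_of_tendsto (f := fun N : ℕ => (N : ℝ)⁻¹ • zc (s N)) (b := atTop) ?_ ?_
  · have hj : Tendsto (fun N : ℕ => (N : ℝ)⁻¹ * j N) atTop (𝓝 0) := by
      refine squeeze_zero (g := fun N : ℕ => (N : ℝ)⁻¹ * 3) (fun N => ?_) (fun N => ?_) ?_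
      · have := hj0 N; positivity
      · have := hj3 N; gcongr
      · simpa using (tendsto_inv_atTop_nhds_zero_nat (𝕜 := ℝ)).mul_const 3
    have hfl : ∀ a ∈ F, Tendsto (fun N : ℕ => ((⌊w a * N⌋₊ : ℕ) : ℝ) / N) atTop (𝓝 (w a)) :=
      fun a ha => (tendsto_nat_floor_mul_div_atTop (hw a ha)).comp tendsto_natCast_atTop_atTop
    have := (tendsto_finsetSum F (fun a ha => (hfl a ha).smul_const a)).add (hj.smul_const (zc a0))
    simp only [zero_smul, add_zero] at this
    refine this.congr fun N => ?_
    rw [hse, smul_add, Finset.smul_sum, smul_smul]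
    congr 1
    refine Finset.sum_congr rfl fun a _ => ?_
    rw [smul_smul, div_eq_inv_mul]
  · filter_upwards [eventually_gt_atTop 0] with N hN
    exact ⟨(N : ℝ)⁻¹, by positivity, s N, hs N, rfl⟩

theorem exists_param {m k : ℕ} (V : Submodule ℝ (Fin m → ℝ)) (hk : Module.finrank ℝ V = k)
    (x : Fin m → ℝ) (hx : x ∈ V) (hx0 : x ≠ 0) :
    0 < k ∧ ∃ (L : (Fin m → ℝ) →ₗ[ℝ] (Fin k → ℝ)) (ψ : (Fin k → ℝ) →ₗ[ℝ] (Fin m → ℝ)),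
      (∀ z, L (ψ z) = z) ∧ (∀ z, ψ z ∈ V) ∧ (∀ y ∈ V, ψ (L y) = y) ∧ ψ 1 = x := by
  have hkpos : 0 < k := by
    rw [← hk]
    exact Module.finrank_pos_iff_exists_ne_zero.2 ⟨⟨x, hx⟩, fun h => hx0 (congrArg Subtype.val h)⟩
  refine ⟨hkpos, ?_⟩
  have : Nonempty (Fin k) := ⟨⟨0, hkpos⟩⟩
  let e : V ≃ₗ[ℝ] (Fin k → ℝ) := (Module.finBasisOfFinrankEq ℝ V hk).equivFun
  have hex : e ⟨x, hx⟩ ≠ 0 := by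
    rw [Ne, LinearEquiv.map_eq_zero_iff]
    exact fun h => hx0 (congrArg Subtype.val h)
  obtain ⟨A, hA⟩ := SeparatingDual.exists_continuousLinearEquiv_apply_eq (R := ℝ) hex
    (one_ne_zero : (1 : Fin k → ℝ) ≠ 0)
  let φ : V ≃ₗ[ℝ] (Fin k → ℝ) := e.trans A.toLinearEquiv
  have hφ : φ ⟨x, hx⟩ = 1 := hA
  obtain ⟨L, hL⟩ := LinearMap.exists_extend (φ : V →ₗ[ℝ] (Fin k → ℝ))
  have hL' : ∀ v : V, L v = φ v := fun v => by
    have := LinearMap.congr_fun hL v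
    simpa using this
  refine ⟨L, V.subtype ∘ₗ (φ.symm : (Fin k → ℝ) →ₗ[ℝ] V), ?_, ?_, ?_, ?_⟩
  · intro z; simp [hL']
  · intro z; simp
  · intro y hy
    have := hL' ⟨y, hy⟩
    simp only at this
    simp [this]
  · rw [← hφ]; simp

/-- the good matrices (rows are the cone generators) -/
def good {k : ℕ} (A : Fin k → Fin k → ℝ) (z : Fin k → ℝ) : Prop :=
  ∀ i, 0 < (Matrix.of A)ᵀ.det * Matrix.cramer (Matrix.of A)ᵀ z i

theorem isOpen_good1 {k : ℕ} (z : Fin k → ℝ) : IsOpen {A : Fin k → Fin k → ℝ | good A z} := by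
  simp only [good, Set.ofPred_forall, Matrix.cramer_eq_adjugate_mulVec]
  refine isOpen_iInter_of_finite fun i => isOpen_lt continuous_const ?_
  have h : Continuous fun A : Fin k → Fin k → ℝ => (Matrix.of A)ᵀ :=
    Continuous.matrix_transpose continuous_id
  exact h.matrix_det.mul
    ((continuous_apply i).comp (h.matrix_adjugate.matrix_mulVec continuous_const))

theorem isOpen_good2 {k : ℕ} (A : Fin k → Fin k → ℝ) : IsOpen {z | good A z} := by
  simp only [good, Set.ofPred_forall]
  refine isOpen_iInter_of_finite fun i => isOpen_lt continuous_const ?_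
  exact continuous_const.mul ((continuous_apply i).comp
    (LinearMap.continuous_of_finiteDimensional (Matrix.cramer (Matrix.of A)ᵀ)))

theorem combo_of_det {k : ℕ} (A : Fin k → Fin k → ℝ) (hd : (Matrix.of A)ᵀ.det ≠ 0)
    (z : Fin k → ℝ) :
    z = ∑ i, ((Matrix.of A)ᵀ.det⁻¹ * Matrix.cramer (Matrix.of A)ᵀ z i) • A i := by
  have h := Matrix.mulVec_cramer (Matrix.of A)ᵀ z
  ext j
  have hj := congrFun h j
  simp only [Matrix.mulVec, dotProduct, Matrix.transpose_apply, Matrix.of_apply, Pi.smul_apply,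
    smul_eq_mul] at hj
  simp only [Finset.sum_apply, Pi.smul_apply, smul_eq_mul]
  have : ∑ i, (Matrix.of A)ᵀ.det⁻¹ * Matrix.cramer (Matrix.of A)ᵀ z i * A i j
      = (Matrix.of A)ᵀ.det⁻¹ * ∑ i, A i j * Matrix.cramer (Matrix.of A)ᵀ z i := by
    rw [Finset.mul_sum]
    exact Finset.sum_congr rfl fun i _ => by ring
  rw [this, hj]
  field_simp

/-- matrix near the all-one matrix -/
theorem good_A0 {k : ℕ} (hk : 0 < k) (t : ℝ) (ht : 0 < t) :
    good (fun i : Fin k => (1 : Fin k → ℝ) + t • Pi.single i 1) 1 := by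
  set M : Matrix (Fin k) (Fin k) ℝ :=
    (Matrix.of (fun i : Fin k => (1 : Fin k → ℝ) + t • Pi.single i 1))ᵀ with hM
  have hmv : ∀ v, M.mulVec v = fun j => ∑ i, v i + t * v j := by
    intro v
    ext j
    simp [hM, Matrix.mulVec, dotProduct, add_mul, Finset.sum_add_distrib, Pi.single_apply]
  have hkr : (0 : ℝ) < k := by exact_mod_cast hk
  have hdet : M.det ≠ 0 := by
    intro h
    obtain ⟨v, hv, h0⟩ := Matrix.exists_mulVec_eq_zero_iff.2 h
    rw [hmv] at h0
    have h0' : ∀ j, ∑ i, v i + t * v j = 0 := fun j => congrFun h0 j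
    have hs : (k + t) * ∑ i, v i = 0 := by
      have : ∑ j : Fin k, (∑ i, v i + t * v j) = 0 := by simp [h0']
      rw [Finset.sum_add_distrib, ← Finset.mul_sum] at this
      simp at this
      linarith
    have hs' : ∑ i, v i = 0 := by
      rcases mul_eq_zero.1 hs with h | h
      · linarith
      · exact h
    apply hv
    ext j
    have := h0' j
    rw [hs', zero_add] at this
    rcases mul_eq_zero.1 this with h | h
    · linarith
    · simpa using h
  have h1 : M.mulVec (fun _ => (k + t)⁻¹) = 1 := by
    rw [hmv]; ext j; simp; field_simp
  have hc : Matrix.cramer M 1 = M.det • fun _ => ((k : ℝ) + t)⁻¹ := by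
    rw [Matrix.cramer_eq_adjugate_mulVec, ← h1, Matrix.mulVec_mulVec, Matrix.adjugate_mul,
      Matrix.smul_mulVec, Matrix.one_mulVec]
  intro i
  rw [← hM, hc]
  simp only [Pi.smul_apply, smul_eq_mul]
  rw [← mul_assoc]
  have := mul_self_pos.2 hdet
  positivity

theorem core {m k : ℕ} (S S' : Set (Fin m → ℤ)) (hS'S : S' ⊆ S) (a0 : Fin m → ℤ) (ha0 : a0 ∈ S)
    (hSadd : ∀ x ∈ S, ∀ y ∈ S, x + y ∈ S)
    (hS' : ∀ u ∈ S, u + a0 ∈ S' ∨ u + a0 + a0 ∈ S')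
    (hdim : Module.finrank ℝ (Submodule.span ℝ (zc '' S)) = k)
    (x : Fin m → ℝ) (hx : x ∈ intrinsicInterior ℝ (coneHull (zc '' S))) (hx0 : x ≠ 0) :
    ∃ a : Fin k → (Fin m → ℤ),
      (∀ i, a i ∈ S') ∧ LinearIndependent ℝ (fun i => zc (a i)) ∧
      Submodule.span ℝ (Set.range fun i => zc (a i)) = Submodule.span ℝ (zc '' S) ∧
      x ∈ intrinsicInterior ℝ (coneHull (Set.range fun i => zc (a i))) := by
  set V := Submodule.span ℝ (zc '' S) with hV
  rw [mem_ii _ V (zero_mem_coneHull _) (span_coneHull _)] at hx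
  obtain ⟨hxV, hxn⟩ := hx
  obtain ⟨hk, L, ψ, hLψ, hψV, hψL, hψ1⟩ := exists_param V hdim x hxV hx0
  have hLc : Continuous L := LinearMap.continuous_of_finiteDimensional L
  have hψc : Continuous ψ := LinearMap.continuous_of_finiteDimensional ψ
  have hnhds : ψ ⁻¹' (coneHull (zc '' S)) ∈ 𝓝 (1 : Fin k → ℝ) := by
    have : Tendsto ψ (𝓝 1) (𝓝[(V : Set (Fin m → ℝ))] x) := by
      rw [tendsto_nhdsWithin_iff]
      exact ⟨hψ1 ▸ hψc.tendsto 1, Eventually.of_forall hψV⟩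
    exact this hxn
  -- choose t
  obtain ⟨t, ht, htm⟩ : ∃ t : ℝ, 0 < t ∧ ∀ i : Fin k,
      (1 : Fin k → ℝ) + t • Pi.single i 1 ∈ ψ ⁻¹' (coneHull (zc '' S)) := by
    have h : ∀ᶠ t : ℝ in 𝓝[>] 0, ∀ i : Fin k,
        (1 : Fin k → ℝ) + t • Pi.single i 1 ∈ ψ ⁻¹' (coneHull (zc '' S)) := by
      rw [eventually_all]
      intro i
      have hc : Continuous fun t : ℝ => (1 : Fin k → ℝ) + t • (Pi.single i 1 : Fin k → ℝ) := by
        fun_prop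
      have := hc.tendsto 0
      simp only [zero_smul, add_zero] at this
      exact (this.mono_left nhdsWithin_le_nhds) hnhds
    obtain ⟨t, h1, h2⟩ := (h.and self_mem_nhdsWithin).exists
    exact ⟨t, h2, h1⟩
  set D : Set (Fin m → ℝ) := {z | ∃ r : ℝ, 0 < r ∧ ∃ s ∈ S', z = r • zc s}
  have hcl : (fun i : Fin k => (1 : Fin k → ℝ) + t • Pi.single i 1) ∈
      closure (Set.pi Set.univ fun _ : Fin k => L '' D) := by
    rw [closure_pi_set]
    intro i _
    have h1 := dense_cone S S' a0 ha0 hSadd hS' _ (htm i)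
    have h2 := image_closure_subset_closure_image hLc (Set.mem_image_of_mem L h1)
    rwa [hLψ] at h2
  obtain ⟨A, hAg, hAD⟩ := mem_closure_iff.1 hcl _ (isOpen_good1 1) (good_A0 hk t ht)
  have hA : ∀ i, ∃ r : ℝ, 0 < r ∧ ∃ s ∈ S', A i = r • L (zc s) := by
    intro i
    obtain ⟨z, ⟨r, hr, s, hs, rfl⟩, hz⟩ := hAD i trivial
    exact ⟨r, hr, s, hs, by rw [← hz, map_smul]⟩
  choose r hr a ha hAa using hA
  have haV : ∀ i, zc (a i) ∈ V := fun i =>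
    Submodule.subset_span (Set.mem_image_of_mem _ (hS'S (ha i)))
  have hψA : ∀ i, ψ (A i) = r i • zc (a i) := fun i => by
    rw [hAa, map_smul, hψL _ (haV i)]
  have hdet : (Matrix.of A)ᵀ.det ≠ 0 := by
    intro h
    have := hAg ⟨0, hk⟩
    rw [h] at this; simp at this
  have hcombo : ∀ y ∈ V, y = ∑ i,
      ((Matrix.of A)ᵀ.det⁻¹ * Matrix.cramer (Matrix.of A)ᵀ (L y) i * r i) • zc (a i) := by
    intro y hy
    have h := congrArg ψ (combo_of_det A hdet (L y))
    rw [hψL y hy, map_sum] at h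
    refine h.trans (Finset.sum_congr rfl fun i _ => ?_)
    rw [map_smul, hψA, smul_smul]
  have hspan : Submodule.span ℝ (Set.range fun i => zc (a i)) = V := by
    apply le_antisymm
    · rw [Submodule.span_le]
      rintro _ ⟨i, rfl⟩
      exact haV i
    · intro y hy
      rw [hcombo y hy]
      exact Submodule.sum_mem _ fun i _ => Submodule.smul_mem _ _ (Submodule.subset_span ⟨i, rfl⟩)
  have hli : LinearIndependent ℝ (fun i => zc (a i)) := by
    rw [linearIndependent_iff_card_eq_finrank_span, Set.finrank, hspan, hdim, Fintype.card_fin]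
  refine ⟨a, ha, hli, hspan, ?_⟩
  rw [mem_ii _ V (zero_mem_coneHull _) ((span_coneHull _).trans hspan)]
  refine ⟨hxV, ?_⟩
  have hLx : L x = 1 := by rw [← hψ1, hLψ]
  have hop : ∀ᶠ y in 𝓝 x, good A (L y) := by
    refine hLc.continuousAt.eventually ((isOpen_good2 A).mem_nhds ?_)
    rw [hLx]; exact hAg
  filter_upwards [mem_nhdsWithin_of_mem_nhds hop, self_mem_nhdsWithin] with y hy hyV
  rw [hcombo y hyV]
  refine sum_mem_coneHull _ hli.injective _ fun i => ?_
  have h1 := hy i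
  refine mul_nonneg ?_ (hr i).le
  have h2 : (Matrix.of A)ᵀ.det⁻¹ * Matrix.cramer (Matrix.of A)ᵀ (L y) i =
      ((Matrix.of A)ᵀ.det⁻¹ * (Matrix.of A)ᵀ.det⁻¹) *
        ((Matrix.of A)ᵀ.det * Matrix.cramer (Matrix.of A)ᵀ (L y) i) := by
    field_simp
  rw [h2]
  exact mul_nonneg (mul_self_nonneg _) h1.le

/-- for a `k`-dimensional vector semigroup `S` and `x ∈ O \ {0}`, there
is a basis `(a₁,…,a_k)` of `lin(S)` with `aᵢ ∈ S` and `x ∈ rint(cone(a₁,…,a_k))`;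
moreover, given a nontrivial semigroup homomorphism `π : S → T`, the `aᵢ` can be
chosen with `π(aᵢ) ≠ 0` for all `i`. -/
theorem stmt11 {m n k : ℕ} (S : Set (Fin m → ℤ)) (hSne : S.Nonempty)
    (hSadd : ∀ x ∈ S, ∀ y ∈ S, x + y ∈ S)
    (hdim : Module.finrank ℝ (Submodule.span ℝ (zc '' S)) = k)
    (T : Set (Fin n → ℤ)) (hTne : T.Nonempty) (hTadd : ∀ x ∈ T, ∀ y ∈ T, x + y ∈ T)
    (π : (Fin m → ℤ) → (Fin n → ℤ)) (hπT : ∀ x ∈ S, π x ∈ T)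
    (hhom : ∀ x ∈ S, ∀ y ∈ S, π (x + y) = π x + π y)
    (x : Fin m → ℝ) (hx : x ∈ intrinsicInterior ℝ (coneHull (zc '' S))) (hx0 : x ≠ 0) :
    (∃ a : Fin k → (Fin m → ℤ),
      (∀ i, a i ∈ S) ∧ LinearIndependent ℝ (fun i => zc (a i)) ∧
      Submodule.span ℝ (Set.range fun i => zc (a i)) = Submodule.span ℝ (zc '' S) ∧
      x ∈ intrinsicInterior ℝ (coneHull (Set.range fun i => zc (a i)))) ∧
    ((∃ a₀ ∈ S, π a₀ ≠ 0) →
      ∃ a : Fin k → (Fin m → ℤ),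
        (∀ i, a i ∈ S) ∧ LinearIndependent ℝ (fun i => zc (a i)) ∧
        Submodule.span ℝ (Set.range fun i => zc (a i)) = Submodule.span ℝ (zc '' S) ∧
        x ∈ intrinsicInterior ℝ (coneHull (Set.range fun i => zc (a i))) ∧
        ∀ i, π (a i) ≠ 0) := by
  constructor
  · obtain ⟨a0, ha0⟩ := hSne
    exact core S S subset_rfl a0 ha0 hSadd (fun u hu => Or.inl (hSadd _ hu _ ha0)) hdim x hx hx0
  · rintro ⟨a0, ha0, hπ⟩
    obtain ⟨a, h1, h2, h3, h4⟩ := core S {s | s ∈ S ∧ π s ≠ 0} (fun s hs => hs.1) a0 ha0 hSadd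
      (fun u hu => by
        have hu1 := hSadd _ hu _ ha0
        by_cases h : π (u + a0) = 0
        · refine Or.inr ⟨hSadd _ hu1 _ ha0, ?_⟩
          rw [hhom _ hu1 _ ha0, h, zero_add]
          exact hπ
        · exact Or.inl ⟨hu1, h⟩) hdim x hx hx0
    exact ⟨a, fun i => (h1 i).1, h2, h3, h4, fun i => (h1 i).2⟩
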